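/- A totally ordered k-uplet (X₁,...,X_k) of random variables on a common finite probability space is geodesic — meaning every totally ordered sub-triplet (X_h, X_i, X_j) with h < i < j satisfies the triangle equality V(X_h,X_j) = V(X_h,X_i) + V(X_i,X_j) — if and only if for every h < i < j both I(X_h;X_j|X_i) = 0 (conditionally independent chain) and H(X_i|(X_h,X_j)) = 0 (deterministic chain). -/

import Mathlib

open Finset

structure FinProb (Ω : Type*) [Fintype Ω] where
  p : Ω → ℝ
  nonneg : ∀ ω, 0 ≤ p ω
  sum_one : ∑ ω, p ω = 1

noncomputable def pmf {Ω α : Type*} [Fintype Ω] [DecidableEq α]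
    (P : FinProb Ω) (X : Ω → α) (x : α) : ℝ :=
  ∑ ω ∈ Finset.univ.filter (fun ω => X ω = x), P.p ω

noncomputable def ent {Ω α : Type*} [Fintype Ω] [Fintype α] [DecidableEq α]
    (c : ℝ) (P : FinProb Ω) (X : Ω → α) : ℝ :=
  -∑ x : α, pmf P X x * Real.logb c (pmf P X x)

noncomputable def jent2 {Ω α β : Type*} [Fintype Ω] [Fintype α] [DecidableEq α]
    [Fintype β] [DecidableEq β] (c : ℝ) (P : FinProb Ω) (X : Ω → α) (Y : Ω → β) : ℝ :=
  ent c P (fun ω => (X ω, Y ω))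

noncomputable def jent3 {Ω α β γ : Type*} [Fintype Ω] [Fintype α] [DecidableEq α]
    [Fintype β] [DecidableEq β] [Fintype γ] [DecidableEq γ]
    (c : ℝ) (P : FinProb Ω) (X : Ω → α) (Y : Ω → β) (Z : Ω → γ) : ℝ :=
  ent c P (fun ω => (X ω, Y ω, Z ω))

noncomputable def mi {Ω α β : Type*} [Fintype Ω] [Fintype α] [DecidableEq α]
    [Fintype β] [DecidableEq β] (c : ℝ) (P : FinProb Ω) (X : Ω → α) (Y : Ω → β) : ℝ :=
  ent c P X + ent c P Y - jent2 c P X Y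

noncomputable def infoDist {Ω α β : Type*} [Fintype Ω] [Fintype α] [DecidableEq α]
    [Fintype β] [DecidableEq β] (c : ℝ) (P : FinProb Ω) (X : Ω → α) (Y : Ω → β) : ℝ :=
  jent2 c P X Y - mi c P X Y

/-- Conditional entropy `H(X|Y)`. -/
noncomputable def condEnt {Ω α β : Type*} [Fintype Ω] [Fintype α] [DecidableEq α]
    [Fintype β] [DecidableEq β] (c : ℝ) (P : FinProb Ω) (X : Ω → α) (Y : Ω → β) : ℝ :=
  jent2 c P X Y - ent c P Y

/-- Conditional mutual information `I(X;Z|Y)`. -/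
noncomputable def cmi {Ω α β γ : Type*} [Fintype Ω] [Fintype α] [DecidableEq α]
    [Fintype β] [DecidableEq β] [Fintype γ] [DecidableEq γ]
    (c : ℝ) (P : FinProb Ω) (X : Ω → α) (Z : Ω → γ) (Y : Ω → β) : ℝ :=
  jent2 c P X Y + jent2 c P Y Z - ent c P Y - jent3 c P X Y Z

lemma sum_pmf_mul {Ω α : Type*} [Fintype Ω] [Fintype α] [DecidableEq α]
    (P : FinProb Ω) (X : Ω → α) (g : α → ℝ) :
    ∑ x, pmf P X x * g x = ∑ ω, P.p ω * g (X ω) := by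
  rw [← Finset.sum_fiberwise (s := Finset.univ) (g := X)]
  refine Finset.sum_congr rfl fun x _ => ?_
  rw [pmf, Finset.sum_mul]
  refine Finset.sum_congr rfl fun ω hω => ?_
  rw [(Finset.mem_filter.1 hω).2]

lemma pmf_nonneg {Ω α : Type*} [Fintype Ω] [DecidableEq α]
    (P : FinProb Ω) (X : Ω → α) (x : α) : 0 ≤ pmf P X x :=
  Finset.sum_nonneg fun ω _ => P.nonneg ω

lemma pmf_pos {Ω α : Type*} [Fintype Ω] [DecidableEq α]
    (P : FinProb Ω) (X : Ω → α) (ω : Ω) (h : 0 < P.p ω) : 0 < pmf P X (X ω) :=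
  lt_of_lt_of_le h (Finset.single_le_sum (f := P.p) (fun ω _ => P.nonneg ω) (by simp))

noncomputable def slog {Ω α : Type*} [Fintype Ω] [DecidableEq α]
    (P : FinProb Ω) (X : Ω → α) : ℝ := ∑ ω, P.p ω * Real.log (pmf P X (X ω))

lemma ent_eq {Ω α : Type*} [Fintype Ω] [Fintype α] [DecidableEq α]
    (c : ℝ) (P : FinProb Ω) (X : Ω → α) : ent c P X = -(slog P X / Real.log c) := by
  rw [ent, sum_pmf_mul P X (fun x => Real.logb c (pmf P X x)), slog, Finset.sum_div]
  simp only [Real.logb, mul_div_assoc]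

lemma slog_perm {Ω α β γ : Type*} [Fintype Ω] [DecidableEq α] [DecidableEq β] [DecidableEq γ]
    (P : FinProb Ω) (X : Ω → α) (Y : Ω → β) (Z : Ω → γ) :
    slog P (fun ω => (Y ω, X ω, Z ω)) = slog P (fun ω => (X ω, Y ω, Z ω)) := by
  unfold slog pmf
  refine Finset.sum_congr rfl fun ω _ => ?_
  congr 3
  ext ω'
  simp only [Finset.mem_filter, Prod.mk.injEq]
  tauto

lemma slog_le {Ω α β : Type*} [Fintype Ω] [DecidableEq α] [DecidableEq β]
    (P : FinProb Ω) (X : Ω → α) (Y : Ω → β) :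
    slog P (fun ω => (X ω, Y ω)) ≤ slog P Y := by
  refine Finset.sum_le_sum fun ω _ => ?_
  rcases (P.nonneg ω).eq_or_lt with h | h
  · simp [← h]
  refine mul_le_mul_of_nonneg_left (Real.log_le_log (pmf_pos P _ ω h) ?_) h.le
  refine Finset.sum_le_sum_of_subset_of_nonneg ?_ fun ω _ _ => P.nonneg ω
  intro ω'
  simp only [Finset.mem_filter, Prod.mk.injEq]
  tauto

lemma pmf_fst {Ω α β : Type*} [Fintype Ω] [Fintype α] [DecidableEq α] [DecidableEq β]
    (P : FinProb Ω) (X : Ω → α) (Y : Ω → β) (y : β) :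
    ∑ x, pmf P (fun ω => (X ω, Y ω)) (x, y) = pmf P Y y := by
  unfold pmf
  rw [← Finset.sum_fiberwise (s := Finset.univ.filter fun ω => Y ω = y) (g := X)]
  refine Finset.sum_congr rfl fun x _ => Finset.sum_congr ?_ fun _ _ => rfl
  ext ω
  simp [and_comm]

lemma pmf_snd {Ω α β : Type*} [Fintype Ω] [Fintype α] [DecidableEq α] [DecidableEq β]
    (P : FinProb Ω) (X : Ω → α) (Y : Ω → β) (y : β) :
    ∑ x, pmf P (fun ω => (Y ω, X ω)) (y, x) = pmf P Y y := by
  rw [← pmf_fst P X Y]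
  refine Finset.sum_congr rfl fun x _ => Finset.sum_congr ?_ fun _ _ => rfl
  ext ω
  simp [and_comm]

lemma sum_pmf {Ω α : Type*} [Fintype Ω] [Fintype α] [DecidableEq α]
    (P : FinProb Ω) (X : Ω → α) : ∑ x, pmf P X x = 1 := by
  have := sum_pmf_mul P X (fun _ => 1)
  simpa [P.sum_one] using this

lemma slog_submod {Ω α β γ : Type*} [Fintype Ω] [Fintype α] [DecidableEq α]
    [Fintype β] [DecidableEq β] [Fintype γ] [DecidableEq γ]
    (P : FinProb Ω) (X : Ω → α) (Y : Ω → β) (Z : Ω → γ) :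
    slog P (fun ω => (X ω, Y ω)) + slog P (fun ω => (Y ω, Z ω)) ≤
      slog P Y + slog P (fun ω => (X ω, Y ω, Z ω)) := by
  set a : α × β → ℝ := pmf P (fun ω => (X ω, Y ω)) with ha
  set b : β × γ → ℝ := pmf P (fun ω => (Y ω, Z ω)) with hb
  set d : β → ℝ := pmf P Y with hd
  set t : α × β × γ → ℝ := pmf P (fun ω => (X ω, Y ω, Z ω)) with ht
  have a0 : ∀ u, 0 ≤ a u := fun u => pmf_nonneg P _ u
  have b0 : ∀ u, 0 ≤ b u := fun u => pmf_nonneg P _ u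
  have d0 : ∀ u, 0 ≤ d u := fun u => pmf_nonneg P _ u
  have t0 : ∀ u, 0 ≤ t u := fun u => pmf_nonneg P _ u
  let g : α × β × γ → ℝ := fun u => a (u.1, u.2.1) * b u.2 / (t u * d u.2.1)
  have hg : ∑ ω, P.p ω * g (X ω, Y ω, Z ω) ≤ 1 := by
    rw [← sum_pmf_mul P (fun ω => (X ω, Y ω, Z ω)) g]
    calc ∑ u, t u * g u ≤ ∑ u : α × β × γ, a (u.1, u.2.1) * b u.2 / d u.2.1 := by
          refine Finset.sum_le_sum fun u _ => ?_
          rcases (t0 u).eq_or_lt with h | h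
          · rw [← h, zero_mul]
            exact div_nonneg (mul_nonneg (a0 _) (b0 _)) (d0 _)
          · apply le_of_eq
            simp only [g]
            rw [← mul_div_assoc, mul_div_mul_left _ _ h.ne']
      _ = ∑ y, d y * d y / d y := by
          rw [Fintype.sum_prod_type]
          simp_rw [Fintype.sum_prod_type]
          rw [Finset.sum_comm]
          refine Finset.sum_congr rfl fun y _ => ?_
          simp_rw [← Finset.sum_div, ← Finset.mul_sum]
          rw [← Finset.sum_mul]
          rw [pmf_fst P X Y y, pmf_snd P Z Y y]
      _ = ∑ y, d y := by simp
      _ ≤ 1 := (sum_pmf P Y).le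
  have key : ∑ ω, P.p ω * (1 - g (X ω, Y ω, Z ω)) ≤
      ∑ ω, P.p ω * (Real.log (d (Y ω)) + Real.log (t (X ω, Y ω, Z ω))
        - Real.log (a (X ω, Y ω)) - Real.log (b (Y ω, Z ω))) := by
    refine Finset.sum_le_sum fun ω _ => ?_
    rcases (P.nonneg ω).eq_or_lt with h | h
    · simp [← h]
    refine mul_le_mul_of_nonneg_left ?_ h.le
    have ap : 0 < a (X ω, Y ω) := pmf_pos P (fun ω => (X ω, Y ω)) ω h
    have bp : 0 < b (Y ω, Z ω) := pmf_pos P (fun ω => (Y ω, Z ω)) ω h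
    have dp : 0 < d (Y ω) := pmf_pos P Y ω h
    have tp : 0 < t (X ω, Y ω, Z ω) := pmf_pos P (fun ω => (X ω, Y ω, Z ω)) ω h
    have gp : 0 < g (X ω, Y ω, Z ω) := by simp only [g]; positivity
    have h1 := Real.log_le_sub_one_of_pos gp
    have h2 : Real.log (g (X ω, Y ω, Z ω)) = Real.log (a (X ω, Y ω)) + Real.log (b (Y ω, Z ω))
        - (Real.log (t (X ω, Y ω, Z ω)) + Real.log (d (Y ω))) := by
      simp only [g]
      rw [Real.log_div (by positivity) (by positivity), Real.log_mul ap.ne' bp.ne',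
        Real.log_mul tp.ne' dp.ne']
    linarith
  simp only [mul_sub, mul_add, Finset.sum_sub_distrib, Finset.sum_add_distrib, mul_one,
    P.sum_one] at key
  simp only [slog]
  linarith

/-- a totally ordered `k`-uplet is geodesic (every ordered sub-triplet
satisfies the triangle equality) iff it is a conditionally independent chain
(`I(X_h;X_j|X_i) = 0`) and a deterministic chain (`H(X_i|(X_h,X_j)) = 0`),
for all `h < i < j`. -/
theorem geodesic_kuplet_iff {Ω α : Type*} [Fintype Ω] [Fintype α] [DecidableEq α]
    {k : ℕ} (c : ℝ) (hc : 1 < c) (P : FinProb Ω) (X : Fin k → Ω → α) :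
    (∀ h i j : Fin k, h < i → i < j →
      infoDist c P (X h) (X j) = infoDist c P (X h) (X i) + infoDist c P (X i) (X j)) ↔
    (∀ h i j : Fin k, h < i → i < j →
      cmi c P (X h) (X j) (X i) = 0 ∧
      condEnt c P (X i) (fun ω => (X h ω, X j ω)) = 0) := by
  have hl : 0 < Real.log c := Real.log_pos hc
  refine forall_congr' fun h => forall_congr' fun i => forall_congr' fun j =>
    imp_congr_right fun _ => imp_congr_right fun _ => ?_
  have hsw : slog P (fun ω => (X i ω, X h ω, X j ω)) = slog P (fun ω => (X h ω, X i ω, X j ω)) :=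
    slog_perm P (X h) (X i) (X j)
  have h1 : 0 ≤ cmi c P (X h) (X j) (X i) := by
    have := div_le_div_of_nonneg_right (slog_submod P (X h) (X i) (X j)) hl.le
    simp only [cmi, jent2, jent3, ent_eq]
    simp only [add_div] at this
    linarith
  have h2 : 0 ≤ condEnt c P (X i) (fun ω => (X h ω, X j ω)) := by
    have := div_le_div_of_nonneg_right (slog_le P (X i) (fun ω => (X h ω, X j ω))) hl.le
    simp only [condEnt, jent2, ent_eq]
    linarith
  have h3 : infoDist c P (X h) (X i) + infoDist c P (X i) (X j) - infoDist c P (X h) (X j) =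
      2 * (cmi c P (X h) (X j) (X i) + condEnt c P (X i) (fun ω => (X h ω, X j ω))) := by
    simp only [infoDist, mi, cmi, condEnt, jent2, jent3, ent_eq, hsw]
    ring
  constructor
  · intro e
    constructor <;> linarith
  · rintro ⟨e1, e2⟩
    linarith
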